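/- Let δ₂ = 1/28. For every elementary graph G and every probability measure μ on V(G), there exists either a clique K in G with μ(K) ≥ 3δ₂, or an anti-adjacent pair (P, Q) in G with μ(P) ≥ δ₂ and μ(Q) ≥ δ₂. -/

import Mathlib

/-- A graph is elementary if its edges can be 2-coloured so that any two edges
`xy`, `yz` sharing an endpoint `y`, with `x` and `z` nonadjacent, get distinct
colours. -/
def IsElementary {V : Type*} (G : SimpleGraph V) : Prop :=
  ∃ c : Sym2 V → Bool, ∀ x y z : V,
    G.Adj x y → G.Adj y z → x ≠ z → ¬ G.Adj x z → c s(x, y) ≠ c s(y, z)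

/-- If `H.dist u w = n + 1`, some neighbour of `u` is at distance `n` from `w`. -/
theorem SimpleGraph.exists_adj_dist_eq_of_dist_eq_succ {V : Type*} {H : SimpleGraph V} {u w : V}
    {n : ℕ} (h : H.dist u w = n + 1) : ∃ x, H.Adj u x ∧ H.dist x w = n := by
  have hr : H.Reachable u w := SimpleGraph.Reachable.of_dist_ne_zero (G := H) (by omega)
  obtain ⟨p, hp⟩ := hr.exists_walk_length_eq_dist
  cases p with
  | nil => simp at h
  | cons hadj q =>
    rename_i x
    refine ⟨x, hadj, ?_⟩
    have h1 := SimpleGraph.dist_le q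
    obtain ⟨q', hq'⟩ := q.reachable.exists_walk_length_eq_dist
    have h2 := SimpleGraph.dist_le (SimpleGraph.Walk.cons hadj q')
    simp only [SimpleGraph.Walk.length_cons] at hp h2
    omega

/-- Distances from adjacent vertices to a common reachable vertex differ by at most one. -/
theorem SimpleGraph.dist_le_succ_of_adj {V : Type*} {H : SimpleGraph V} {u v w : V}
    (h : H.Adj u v) (hr : H.Reachable v w) : H.dist u w ≤ H.dist v w + 1 := by
  obtain ⟨q, hq⟩ := hr.exists_walk_length_eq_dist
  have := SimpleGraph.dist_le (SimpleGraph.Walk.cons h q)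
  simp only [SimpleGraph.Walk.length_cons] at this
  omega

/-- `H` is a colour class of an edge colouring of `G` witnessing that `G` is elementary. -/
structure IsElementaryColorClass {V : Type*} (G H : SimpleGraph V) : Prop where
  le : H ≤ G
  adj_of_adj : ∀ {x y z : V}, H.Adj x y → H.Adj y z → x ≠ z → G.Adj x z
  adj_of_not_adj : ∀ {x y z : V}, G.Adj x y → ¬ H.Adj x y → G.Adj y z → ¬ H.Adj y z →
    x ≠ z → G.Adj x z

namespace IsElementaryColorClass

variable {V : Type*} {G H : SimpleGraph V}

theorem not_adj_of_two_le {u w : V} (h : 2 ≤ H.dist u w) : ¬ H.Adj u w := by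
  intro hadj
  have := SimpleGraph.dist_eq_one_iff_adj.mpr hadj
  omega

theorem ne_of_two_le {u w : V} (h : 2 ≤ H.dist u w) : u ≠ w := by
  rintro rfl
  simp at h

/-- Vertices at positive even distance in a colour class are adjacent in the graph. -/
theorem adj_of_dist_even (hH : IsElementaryColorClass G H) (k : ℕ) :
    ∀ {u w : V}, H.dist u w = 2 * k + 2 → G.Adj u w := by
  induction k with
  | zero =>
    intro u w h
    obtain ⟨x, hux, hx⟩ := SimpleGraph.exists_adj_dist_eq_of_dist_eq_succ h
    exact hH.adj_of_adj hux (SimpleGraph.dist_eq_one_iff_adj.mp hx) (ne_of_two_le (H := H) (by omega))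
  | succ k ih =>
    intro u w h
    obtain ⟨x, hux, hx⟩ := SimpleGraph.exists_adj_dist_eq_of_dist_eq_succ h
    obtain ⟨y, hxy, hy⟩ := SimpleGraph.exists_adj_dist_eq_of_dist_eq_succ hx
    have hrw : H.Reachable y w := SimpleGraph.Reachable.of_dist_ne_zero (by omega)
    have huy : u ≠ y := by rintro rfl; omega
    refine hH.adj_of_not_adj (hH.adj_of_adj hux hxy huy) (fun hadj => ?_) (ih hy)
      (not_adj_of_two_le (by omega)) (ne_of_two_le (H := H) (by omega))
    have := SimpleGraph.dist_le_succ_of_adj hadj hrw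
    omega

theorem adj_of_even (hH : IsElementaryColorClass G H) {u w : V} (h2 : 2 ≤ H.dist u w)
    (he : Even (H.dist u w)) : G.Adj u w := by
  obtain ⟨m, hm⟩ := he
  exact hH.adj_of_dist_even (m - 1) (by omega)

/-- A reachable vertex not adjacent in `G` is at odd distance at least three. -/
theorem exists_dist_eq (hH : IsElementaryColorClass G H) {v t : V}
    (ht : H.Reachable v t) (hne : v ≠ t) (hvt : ¬ G.Adj v t) :
    ∃ k, H.dist v t = 2 * k + 3 := by
  have h0 := ht.pos_dist_of_ne hne
  have h1 : H.dist v t ≠ 1 := fun h => hvt (hH.le (SimpleGraph.dist_eq_one_iff_adj.mp h))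
  have h2 : ¬ Even (H.dist v t) := fun h => hvt (hH.adj_of_even (by omega) h)
  rw [Nat.not_even_iff_odd] at h2
  obtain ⟨m, hm⟩ := h2
  exact ⟨m - 1, by omega⟩

/-- Within a component of a colour class, the non-neighbours of a vertex form a clique. -/
theorem adj_of_not_adj_of_not_adj (hH : IsElementaryColorClass G H) {v t t' : V}
    (ht : H.Reachable v t) (ht' : H.Reachable v t') (hne : v ≠ t) (hne' : v ≠ t')
    (hvt : ¬ G.Adj v t) (hvt' : ¬ G.Adj v t') (htt' : t ≠ t') : G.Adj t t' := by
  by_contra hcon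
  have mid : ∀ {s x : V}, 2 ≤ H.dist s x → 2 ≤ H.dist x v → G.Adj x v → ¬ G.Adj v s →
      v ≠ s → ¬ Even (H.dist s x) := fun h2 h2' hxv hvs hns he =>
    hvs (hH.adj_of_not_adj (hH.adj_of_even h2 he) (not_adj_of_two_le h2) hxv
      (not_adj_of_two_le h2') hns.symm).symm
  obtain ⟨k, hk⟩ := hH.exists_dist_eq ht hne hvt
  obtain ⟨k', hk'⟩ := hH.exists_dist_eq ht' hne' hvt'
  obtain ⟨a, hva, ha⟩ := SimpleGraph.exists_adj_dist_eq_of_dist_eq_succ hk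
  obtain ⟨a', hva', ha'⟩ := SimpleGraph.exists_adj_dist_eq_of_dist_eq_succ hk'
  obtain ⟨b', hab', hb'⟩ := SimpleGraph.exists_adj_dist_eq_of_dist_eq_succ ha'
  have hat : G.Adj a t := hH.adj_of_dist_even k ha
  have hat' : G.Adj a' t' := hH.adj_of_dist_even k' ha'
  have hatH : ¬ H.Adj a t := not_adj_of_two_le (by omega)
  have hatH' : ¬ H.Adj a' t' := not_adj_of_two_le (by omega)
  have hrb : H.Reachable v b' := hva'.reachable.trans hab'.reachable
  have odd_a : H.dist a t' = 2 * k' + 3 := by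
    have h1 := SimpleGraph.dist_le_succ_of_adj hva (hva.reachable.symm.trans ht')
    have h2 := SimpleGraph.dist_le_succ_of_adj hva.symm ht'
    have h3 : ¬ Even (H.dist a t') := fun he =>
      hcon (hH.adj_of_not_adj hat.symm (fun h => hatH h.symm) (hH.adj_of_even (by omega) he)
        (not_adj_of_two_le (by omega)) htt')
    rw [Nat.not_even_iff_odd] at h3
    obtain ⟨m, hm⟩ := h3
    omega
  have odd_a' : H.dist a' t = 2 * k + 3 := by
    have h1 := SimpleGraph.dist_le_succ_of_adj hva' (hva'.reachable.symm.trans ht)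
    have h2 := SimpleGraph.dist_le_succ_of_adj hva'.symm ht
    have h3 : ¬ Even (H.dist a' t) := fun he =>
      hcon (hH.adj_of_not_adj hat'.symm (fun h => hatH' h.symm) (hH.adj_of_even (by omega) he)
        (not_adj_of_two_le (by omega)) htt'.symm).symm
    rw [Nat.not_even_iff_odd] at h3
    obtain ⟨m, hm⟩ := h3
    omega
  have hvb : v ≠ b' := by rintro rfl; omega
  have hvbG : G.Adj v b' := hH.adj_of_adj hva' hab' hvb
  have hvbH : ¬ H.Adj v b' := fun h => by
    have := SimpleGraph.dist_le_succ_of_adj h (hrb.symm.trans ht')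
    omega
  have hbt : ¬ (G.Adj b' t ∧ ¬ H.Adj b' t) := fun h =>
    hvt (hH.adj_of_not_adj hvbG hvbH h.1 h.2 hne)
  have odd_b' : 3 ≤ H.dist b' t := by
    have h1 := SimpleGraph.dist_le_succ_of_adj hab' (hrb.symm.trans ht)
    have h3 : ¬ Even (H.dist b' t) := fun he =>
      hbt ⟨hH.adj_of_even (by omega) he, not_adj_of_two_le (by omega)⟩
    rw [Nat.not_even_iff_odd] at h3
    obtain ⟨m, hm⟩ := h3
    omega
  have haa : a ≠ a' := by rintro rfl; omega
  have haaG : G.Adj a a' := hH.adj_of_adj hva.symm hva' haa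
  by_cases haaH : H.Adj a a'
  · have hab : a ≠ b' := by rintro rfl; omega
    have habH : ¬ H.Adj a b' := fun h => by
      have := SimpleGraph.dist_le_succ_of_adj h (hrb.symm.trans ht')
      omega
    exact hbt ⟨hH.adj_of_not_adj (hH.adj_of_adj haaH hab' hab).symm (fun h => habH h.symm) hat hatH
      (ne_of_two_le (H := H) (by omega)), not_adj_of_two_le (by omega)⟩
  · have : G.Adj a' t := hH.adj_of_not_adj haaG.symm (fun h => haaH h.symm) hat hatH
      (ne_of_two_le (H := H) (by omega))
    exact hcon (hH.adj_of_not_adj this.symm (fun h => not_adj_of_two_le (by omega) h.symm)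
      hat' hatH' htt')

open Classical in
/-- If all cliques have weight less than `r`, components of a colour class have weight less
than `3 * r`. -/
theorem sum_component_lt (hH : IsElementaryColorClass G H) [Fintype V] {μ : V → ℝ}
    (hμ0 : ∀ v, 0 ≤ μ v) {r : ℝ}
    (hr : ∀ K : Finset V, G.IsClique (K : Set V) → ∑ v ∈ K, μ v < r)
    (C : H.ConnectedComponent) :
    ∑ v with H.connectedComponentMk v = C, μ v < 3 * r := by
  obtain ⟨v, rfl⟩ := C.exists_rep
  have h1 := hr {x | H.Adj v x} (by
    intro x hx y hy hxy
    simp only [Finset.coe_filter, Finset.mem_univ, true_and, Set.mem_ofPred_eq] at hx hy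
    exact hH.adj_of_adj hx.symm hy hxy)
  have h2 := hr {x | x = v ∨ (G.Adj v x ∧ ¬ H.Adj v x)} (by
    intro x hx y hy hxy
    simp only [Finset.coe_filter, Finset.mem_univ, true_and, Set.mem_ofPred_eq] at hx hy
    rcases hx with rfl | hx <;> rcases hy with rfl | hy
    · exact absurd rfl hxy
    · exact hy.1
    · exact hx.1.symm
    · exact hH.adj_of_not_adj hx.1.symm (fun h => hx.2 h.symm) hy.1 hy.2 hxy)
  have h3 := hr {x | H.Reachable v x ∧ v ≠ x ∧ ¬ G.Adj v x} (by
    intro x hx y hy hxy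
    simp only [Finset.coe_filter, Finset.mem_univ, true_and, Set.mem_ofPred_eq] at hx hy
    exact hH.adj_of_not_adj_of_not_adj hx.1 hy.1 hx.2.1 hy.2.1 hx.2.2 hy.2.2 hxy)
  refine lt_of_le_of_lt (b := ∑ x with H.Adj v x, μ x +
    ∑ x with x = v ∨ (G.Adj v x ∧ ¬ H.Adj v x), μ x +
    ∑ x with H.Reachable v x ∧ v ≠ x ∧ ¬ G.Adj v x, μ x) ?_ (by linarith)
  · simp only [Finset.sum_filter, ← Finset.sum_add_distrib]
    refine Finset.sum_le_sum fun x _ => ?_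
    have h0 := hμ0 x
    by_cases hx : H.connectedComponentMk x = H.connectedComponentMk v
    · have hreach : H.Reachable v x := (SimpleGraph.ConnectedComponent.exact hx).symm
      have : H.Adj v x ∨ (x = v ∨ (G.Adj v x ∧ ¬ H.Adj v x)) ∨
          (H.Reachable v x ∧ v ≠ x ∧ ¬ G.Adj v x) := by
        by_cases hxv : x = v
        · exact Or.inr (Or.inl (Or.inl hxv))
        · have := Ne.symm hxv
          tauto
      split_ifs <;> first | linarith | tauto
    · rw [if_neg (by exact hx)]
      split_ifs <;> linarith

end IsElementaryColorClass

open Classical in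
/-- A map to a finite type whose fibres have weight at most `1 - 2 * d` can be cut into two parts
of weight at least `d`. -/
theorem exists_finset_balanced {V ι : Type*} [Fintype V] [Fintype ι] (f : V → ι) {μ : V → ℝ}
    (hμ1 : ∑ v, μ v = 1) {d : ℝ} (hd : 0 < d) (hd1 : d ≤ 1)
    (hf : ∀ i, ∑ v with f v = i, μ v ≤ 1 - 2 * d) :
    ∃ S : Finset ι, d ≤ ∑ v with f v ∈ S, μ v ∧ d ≤ ∑ v with f v ∉ S, μ v := by
  have hcompl (S : Finset ι) : ∑ v with f v ∈ S, μ v + ∑ v with f v ∉ S, μ v = 1 := by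
    rw [Finset.sum_filter_add_sum_filter_not, hμ1]
  obtain ⟨S, hS, hmax⟩ := Finset.exists_max_image
    ({S | ∑ v with f v ∈ S, μ v ≤ 1 - d} : Finset (Finset ι)) Finset.card
    ⟨∅, by simpa using hd1⟩
  simp only [Finset.mem_filter, Finset.mem_univ, true_and] at hS hmax
  refine ⟨S, ?_, by linarith [hcompl S]⟩
  obtain ⟨i, hi⟩ : ∃ i, i ∉ S := by
    by_contra! h
    simp only [h, Finset.filter_true, hμ1] at hS
    linarith
  by_contra hlt
  have hins : ∑ v with f v ∈ insert i S, μ v =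
      ∑ v with f v = i, μ v + ∑ v with f v ∈ S, μ v := by
    simp only [Finset.sum_filter, ← Finset.sum_add_distrib]
    refine Finset.sum_congr rfl fun v _ => ?_
    by_cases hv : f v = i
    · simp [hv, hi]
    · simp [hv]
  have := hmax (insert i S) (by rw [hins]; linarith [hf i])
  rw [Finset.card_insert_of_notMem hi] at this
  omega

/-- The colour classes of the colouring in the definition of elementary graphs. -/
def colorGraph {V : Type*} (G : SimpleGraph V) (c : Sym2 V → Bool) (b : Bool) : SimpleGraph V where
  Adj x y := G.Adj x y ∧ c s(x, y) = b
  symm := ⟨fun x y h => ⟨h.1.symm, by rw [Sym2.eq_swap]; exact h.2⟩⟩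
  loopless := ⟨fun x h => G.loopless.irrefl x h.1⟩

theorem isElementaryColorClass_colorGraph {V : Type*} {G : SimpleGraph V} {c : Sym2 V → Bool}
    (hc : ∀ x y z : V,
      G.Adj x y → G.Adj y z → x ≠ z → ¬ G.Adj x z → c s(x, y) ≠ c s(y, z)) (b : Bool) :
    IsElementaryColorClass G (colorGraph G c b) where
  le _ _ h := h.1
  adj_of_adj {x y z} h h' hne := by
    by_contra hn
    exact hc x y z h.1 h'.1 hne hn (h.2.trans h'.2.symm)
  adj_of_not_adj {x y z} h hH h' hH' hne := by
    by_contra hn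
    have h1 : c s(x, y) = !b := Bool.eq_not_of_ne fun e => hH ⟨h, e⟩
    have h2 : c s(y, z) = !b := Bool.eq_not_of_ne fun e => hH' ⟨h', e⟩
    exact hc x y z h h' hne hn (h1.trans h2.symm)

/-- Lemma 3.8: with `δ₂ = 1/28`, every elementary graph with a probability measure
`μ` on its vertices contains a clique of measure `≥ 3δ₂` or an anti-adjacent pair
each of measure `≥ δ₂`. -/
theorem stmt_7 {V : Type*} [Fintype V] [DecidableEq V] (G : SimpleGraph V)
    (helem : IsElementary G)
    (μ : V → ℝ) (hμ0 : ∀ v, 0 ≤ μ v) (hμ1 : ∑ v, μ v = 1) :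
    (∃ K : Finset V, G.IsClique (K : Set V) ∧ 3 * (1 / 28 : ℝ) ≤ ∑ v ∈ K, μ v) ∨
    (∃ P Q : Finset V, Disjoint P Q ∧ (∀ p ∈ P, ∀ q ∈ Q, ¬ G.Adj p q) ∧
      (1 / 28 : ℝ) ≤ ∑ v ∈ P, μ v ∧ (1 / 28 : ℝ) ≤ ∑ v ∈ Q, μ v) := by
  classical
  by_cases hK : ∃ K : Finset V, G.IsClique (K : Set V) ∧ 3 * (1 / 28 : ℝ) ≤ ∑ v ∈ K, μ v
  · exact Or.inl hK
  refine Or.inr ?_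
  push Not at hK
  obtain ⟨c, hc⟩ := helem
  let R := colorGraph G c true
  let B := colorGraph G c false
  let f : V → R.ConnectedComponent := R.connectedComponentMk
  let g : V → B.ConnectedComponent := B.connectedComponentMk
  have hfg : ∀ x y, G.Adj x y → f x = f y ∨ g x = g y := by
    intro x y h
    cases hb : c s(x, y)
    · exact Or.inr (SimpleGraph.ConnectedComponent.sound (show B.Adj x y from ⟨h, hb⟩).reachable)
    · exact Or.inl (SimpleGraph.ConnectedComponent.sound (show R.Adj x y from ⟨h, hb⟩).reachable)
  obtain ⟨S, hS, hS'⟩ := exists_finset_balanced f hμ1 (d := 2 / 28) (by norm_num) (by norm_num) fun i => by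
    have := (isElementaryColorClass_colorGraph hc true).sum_component_lt hμ0 hK i
    exact this.le.trans (by norm_num)
  obtain ⟨T, hT, hT'⟩ := exists_finset_balanced g hμ1 (d := 2 / 28) (by norm_num) (by norm_num) fun i => by
    have := (isElementaryColorClass_colorGraph hc false).sum_component_lt hμ0 hK i
    exact this.le.trans (by norm_num)
  rw [← Finset.sum_filter_add_sum_filter_not _ (fun v => g v ∈ T)] at hS hS'
  rw [← Finset.sum_filter_add_sum_filter_not _ (fun v => f v ∈ S)] at hT hT'
  simp only [Finset.filter_filter] at hS hS' hT hT'
  simp only [and_comm (a := g _ ∈ T), and_comm (a := g _ ∉ T)] at hT hT'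
  by_cases h1 : 1 / 28 ≤ ∑ v with f v ∈ S ∧ g v ∈ T, μ v ∧
      1 / 28 ≤ ∑ v with f v ∉ S ∧ g v ∉ T, μ v
  · refine ⟨_, _, ?_, ?_, h1⟩
    · rw [Finset.disjoint_filter]
      tauto
    · intro p hp q hq hadj
      simp only [Finset.mem_filter, Finset.mem_univ, true_and] at hp hq
      rcases hfg p q hadj with h | h <;> rw [h] at hp <;> tauto
  by_cases h2 : 1 / 28 ≤ ∑ v with f v ∈ S ∧ g v ∉ T, μ v ∧
      1 / 28 ≤ ∑ v with f v ∉ S ∧ g v ∈ T, μ v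
  · refine ⟨_, _, ?_, ?_, h2⟩
    · rw [Finset.disjoint_filter]
      tauto
    · intro p hp q hq hadj
      simp only [Finset.mem_filter, Finset.mem_univ, true_and] at hp hq
      rcases hfg p q hadj with h | h <;> rw [h] at hp <;> tauto
  exfalso
  rw [not_and_or, not_le, not_le] at h1 h2
  rcases h1 with h1 | h1 <;> rcases h2 with h2 | h2 <;> linarith
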